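/- Let N = 2 and let W be a finite-dimensional gl_2-module. Then any non-constant element ĝ ∈ ℂ[x_{pj} : 1 ≤ p ≤ 2, j ≥ 1] ⊗ W that is homogeneous in both total length and total degree and satisfies Q_a(r,z)_− ĝ = 0 for a = 1, 2 has total length 1. -/

import Mathlib

noncomputable section

/-- The space `ℂ[x_{pj} : 1 ≤ p ≤ 2, j ≥ 1] ⊗ W`, realized as finitely supported
`W`-valued functions on monomials. -/
abbrev PolW (W : Type*) [AddCommGroup W] [Module ℂ W] : Type _ :=
  ((Fin 2 × ℕ+) →₀ ℕ) →₀ W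

variable {W : Type*} [AddCommGroup W] [Module ℂ W]

/-- Multiplication by the variable `x_v`. -/
noncomputable def mulX (v : Fin 2 × ℕ+) : Module.End ℂ (PolW W) :=
  Finsupp.lmapDomain W ℂ (· + Finsupp.single v 1)

/-- The partial derivative `∂/∂x_v`. -/
noncomputable def pdv (v : Fin 2 × ℕ+) : Module.End ℂ (PolW W) :=
  Finsupp.lsum ℂ fun m =>
    (m v : ℂ) • (Finsupp.lsingle (m - Finsupp.single v 1) : W →ₗ[ℂ] PolW W)

/-- The operator on `ℂ[x_{pj}] ⊗ W` induced by an endomorphism of `W`. -/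
noncomputable def rhoOp (E : Module.End ℂ W) : Module.End ℂ (PolW W) :=
  Finsupp.mapRange.linearMap E

/-- The family of operators `ρ p a` is a representation of `gl_2`. -/
def IsGLRep (ρ : Fin 2 → Fin 2 → Module.End ℂ W) : Prop :=
  ∀ p a b c, ⁅ρ p a, ρ b c⁆ =
    (if a = b then ρ p c else 0) - (if c = p then ρ b a else 0)

/-- `Fop2 p t m` is the coefficient of `z^{-m}` in the `t`-th power of
`Σ_{j≥1} z^{-j} ∂/∂x_{pj}`. -/
noncomputable def Fop2 (p : Fin 2) : ℕ → ℕ → Module.End ℂ (PolW W)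
  | 0, m => if m = 0 then 1 else 0
  | t+1, m => ∑ j ∈ (Finset.Icc 1 m).attach,
      pdv (p, ⟨j.1, by have := (Finset.mem_Icc.mp j.2).1; omega⟩) ∘ₗ Fop2 p t (m - j.1)

/-- The coefficient of `r_1^{s_1} r_2^{s_2} z^{-m}` in
`exp(−Σ_p r_p Σ_{j≥1} z^{-j} ∂/∂x_{pj})`. -/
noncomputable def ex2 (s : Fin 2 → ℕ) (m : ℕ) : Module.End ℂ (PolW W) :=
  (((-1 : ℂ) ^ (s 0 + s 1)) / (((s 0).factorial : ℂ) * ((s 1).factorial : ℂ))) •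
    ∑ m₁ ∈ Finset.range (m + 1), Fop2 0 (s 0) m₁ ∘ₗ Fop2 1 (s 1) (m - m₁)

/-- The coefficient of `r^s z^{-j}` (`j ≥ 1`) in `Q_a(r,z) g`, where
`Q_a(r,z) = (Σ_{i≥1} x_{ai} z^i + Σ_p r_p ρ(E^{pa})) ∘ exp(−Σ_p r_p Σ_j z^{-j} ∂/∂x_{pj})
+ exp(−Σ_p r_p Σ_j z^{-j} ∂/∂x_{pj}) ∘ (Σ_p r_p Σ_{k≥1} (Σ_{i=1}^{k-1} x_{ai} z^i) z^{-k}
∂/∂x_{pk})`. -/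
noncomputable def qCoef2 (ρ : Fin 2 → Fin 2 → Module.End ℂ W) (a : Fin 2)
    (s : Fin 2 → ℕ) (j : ℕ+) (g : PolW W) : PolW W :=
  (∑ᶠ i : ℕ+, mulX (a, i) (ex2 s ((i : ℕ) + (j : ℕ)) g))
  + (∑ p : Fin 2, if s p = 0 then 0 else
      rhoOp (ρ p a) (ex2 (Function.update s p (s p - 1)) (j : ℕ) g))
  + (∑ p : Fin 2, if s p = 0 then 0 else ∑ᶠ k : ℕ+, ∑ᶠ i : ℕ+,
      if (i : ℕ) < (k : ℕ) ∧ (k : ℕ) ≤ (i : ℕ) + (j : ℕ) then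
        ex2 (Function.update s p (s p - 1)) ((i : ℕ) + (j : ℕ) - (k : ℕ))
          (mulX (a, i) (pdv (p, k) g))
      else 0)


theorem mulX_single (v : Fin 2 × ℕ+) (m : (Fin 2 × ℕ+) →₀ ℕ) (w : W) :
    mulX v (Finsupp.single m w) = Finsupp.single (m + Finsupp.single v 1) w := by
  simp [mulX]

theorem pdv_single (v : Fin 2 × ℕ+) (m : (Fin 2 × ℕ+) →₀ ℕ) (w : W) :
    pdv v (Finsupp.single m w) = (m v : ℂ) • Finsupp.single (m - Finsupp.single v 1) w := by
  simp [pdv]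

theorem rhoOp_single (E : Module.End ℂ W) (m : (Fin 2 × ℕ+) →₀ ℕ) (w : W) :
    rhoOp E (Finsupp.single m w) = Finsupp.single m (E w) := by
  simp [rhoOp]

theorem tsub_comm_aux (v v' : Fin 2 × ℕ+) (h : v ≠ v') (m : (Fin 2 × ℕ+) →₀ ℕ) (hm : m v ≠ 0) :
    m + Finsupp.single v' 1 - Finsupp.single v 1 = m - Finsupp.single v 1 + Finsupp.single v' 1 := by
  ext x
  simp only [Finsupp.tsub_apply, Finsupp.add_apply, Finsupp.single_apply]
  by_cases h1 : v = x
  · subst h1; simp [Ne.symm h]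
  · simp [h1]

theorem pdv_mulX_ne (v v' : Fin 2 × ℕ+) (h : v ≠ v') :
    (pdv v * mulX v' : Module.End ℂ (PolW W)) = mulX v' * pdv v := by
  refine Finsupp.lhom_ext fun m w => ?_
  simp only [Module.End.mul_apply, mulX_single, pdv_single, map_smul]
  by_cases hm : m v = 0
  · simp [hm, Finsupp.single_apply, Ne.symm h]
  · rw [tsub_comm_aux v v' h m hm]
    simp [Finsupp.single_apply, Ne.symm h]

theorem pdv_mulX_self (v : Fin 2 × ℕ+) :
    (pdv v * mulX v : Module.End ℂ (PolW W)) = mulX v * pdv v + 1 := by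
  refine Finsupp.lhom_ext fun m w => ?_
  simp only [Module.End.mul_apply, LinearMap.add_apply, Module.End.one_apply, mulX_single,
    pdv_single, map_smul]
  by_cases hm : m v = 0
  · simp [hm]
  · have : m - Finsupp.single v 1 + Finsupp.single v 1 = m := by
      ext x
      simp only [Finsupp.tsub_apply, Finsupp.add_apply, Finsupp.single_apply]
      by_cases h1 : v = x
      · subst h1; simp; omega
      · simp [h1]
    rw [this]
    simp [add_smul]

theorem pdv_comm (v v' : Fin 2 × ℕ+) :
    (pdv v * pdv v' : Module.End ℂ (PolW W)) = pdv v' * pdv v := by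
  by_cases h : v = v'
  · subst h; rfl
  refine Finsupp.lhom_ext fun m w => ?_
  simp only [Module.End.mul_apply, pdv_single, map_smul, smul_smul]
  rw [tsub_right_comm]
  simp [Finsupp.single_apply, h, Ne.symm h, mul_comm]

theorem rhoOp_pdv (E : Module.End ℂ W) (v : Fin 2 × ℕ+) :
    (rhoOp E * pdv v : Module.End ℂ (PolW W)) = pdv v * rhoOp E := by
  refine Finsupp.lhom_ext fun m w => ?_
  simp only [Module.End.mul_apply, pdv_single, map_smul, rhoOp_single]

theorem mulX_pdv_apply (v : Fin 2 × ℕ+) (f : PolW W) (μ : (Fin 2 × ℕ+) →₀ ℕ) :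
    (mulX v (pdv v f)) μ = (μ v : ℂ) • f μ := by
  induction f using Finsupp.induction_linear with
  | zero => simp
  | add f g hf hg => simp [hf, hg]
  | single m w =>
    simp only [pdv_single, map_smul, mulX_single]
    by_cases hm : m v = 0
    · simp only [hm, Nat.cast_zero, zero_smul, Finsupp.coe_zero, Pi.zero_apply,
        Finsupp.single_apply]
      split_ifs with h
      · subst h; simp [hm]
      · simp
    · have : m - Finsupp.single v 1 + Finsupp.single v 1 = m := by
        ext x
        simp only [Finsupp.tsub_apply, Finsupp.add_apply, Finsupp.single_apply]
        by_cases h1 : v = x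
        · subst h1; simp; omega
        · simp [h1]
      rw [this, Finsupp.smul_apply, Finsupp.single_apply]
      split_ifs with h
      · subst h; rfl
      · simp

/-! ### Sequences with values in `PolW W` (power series in `u = z⁻¹`) -/

/-- pointwise operator -/
def pt (φ : Module.End ℂ (PolW W)) : Module.End ℂ (ℕ → PolW W) where
  toFun f m := φ (f m)
  map_add' f g := by ext1 m; simp
  map_smul' c f := by ext1 m; simp

/-- multiplication by `u ^ k` -/
def Sh (k : ℕ) : Module.End ℂ (ℕ → PolW W) where
  toFun f m := if k ≤ m then f (m - k) else 0
  map_add' f g := by ext1 m; by_cases h : k ≤ m <;> simp [h]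
  map_smul' c f := by ext1 m; by_cases h : k ≤ m <;> simp [h]

/-- `u d/du` -/
def th : Module.End ℂ (ℕ → PolW W) where
  toFun f m := (m : ℂ) • f m
  map_add' f g := by ext1 m; simp
  map_smul' c f := by ext1 m; simp [smul_comm c]

/-- constant sequence -/
def io (g : PolW W) : ℕ → PolW W := fun m => if m = 0 then g else 0

theorem pt_apply (φ : Module.End ℂ (PolW W)) (f : ℕ → PolW W) (m : ℕ) : pt φ f m = φ (f m) := rfl
theorem Sh_apply (k : ℕ) (f : ℕ → PolW W) (m : ℕ) :
    Sh k f m = if k ≤ m then f (m - k) else 0 := rfl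
theorem th_apply (f : ℕ → PolW W) (m : ℕ) : th f m = (m : ℂ) • f m := rfl

theorem pt_mul (φ ψ : Module.End ℂ (PolW W)) : pt (φ * ψ) = pt φ * pt ψ := rfl
theorem pt_one : pt (1 : Module.End ℂ (PolW W)) = 1 := rfl
theorem pt_add (φ ψ : Module.End ℂ (PolW W)) : pt (φ + ψ) = pt φ + pt ψ := rfl
theorem pt_smul (c : ℂ) (φ : Module.End ℂ (PolW W)) : pt (c • φ) = c • pt φ := rfl

theorem Sh_mul (k l : ℕ) : (Sh k * Sh l : Module.End ℂ (ℕ → PolW W)) = Sh (k + l) := by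
  refine LinearMap.ext fun f => ?_
  ext1 m
  simp only [Module.End.mul_apply, Sh_apply]
  split_ifs <;> first | omega | rfl | (congr 1; omega)

theorem pt_Sh (k : ℕ) (φ : Module.End ℂ (PolW W)) : pt φ * Sh k = Sh k * pt φ := by
  refine LinearMap.ext fun f => ?_
  ext1 m
  simp only [Module.End.mul_apply, Sh_apply, pt_apply]
  split_ifs <;> simp

theorem th_pt (φ : Module.End ℂ (PolW W)) : th * pt φ = pt φ * th := by
  refine LinearMap.ext fun f => ?_
  ext1 m
  simp [Module.End.mul_apply, th_apply, pt_apply]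

theorem th_Sh (k : ℕ) : (th * Sh k : Module.End ℂ (ℕ → PolW W)) = Sh k * th + (k : ℂ) • Sh k := by
  refine LinearMap.ext fun f => ?_
  ext1 m
  simp only [Module.End.mul_apply, th_apply, Sh_apply, LinearMap.add_apply, LinearMap.smul_apply,
    Pi.add_apply, Pi.smul_apply]
  split_ifs with h
  · rw [← add_smul]; congr 1; push_cast [h]; ring
  · simp

theorem Sh_inj (k : ℕ) (f : ℕ → PolW W) (h : Sh k f = 0) : f = 0 := by
  ext1 m
  have := congrFun h (m + k)
  simpa [Sh_apply] using this

theorem th_io (g : PolW W) : th (io g) = 0 := by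
  ext1 m
  by_cases h : m = 0 <;> simp [th_apply, io, h]

/-- eigenvectors with distinct eigenvalues -/
theorem eig_indep {M : Type*} [AddCommGroup M] [Module ℂ M] (C : Module.End ℂ M) (b : ℂ)
    (F : Finset ℕ+) (f : ℕ+ → M) (h : ∀ k ∈ F, C (f k) = (b + ((k : ℕ) : ℂ)) • f k)
    (hs : ∑ k ∈ F, f k = 0) : ∀ k ∈ F, f k = 0 := by
  classical
  induction F using Finset.induction_on generalizing f with
  | empty => simp
  | insert a F ha ih =>
    have h1 : ∑ k ∈ F, (((k : ℕ) : ℂ) - ((a : ℕ) : ℂ)) • f k = 0 := by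
      have h2 : C (∑ k ∈ insert a F, f k) - (b + ((a : ℕ) : ℂ)) • (∑ k ∈ insert a F, f k) = 0 := by
        rw [hs]; simp
      rw [map_sum, Finset.smul_sum, ← Finset.sum_sub_distrib, Finset.sum_insert ha,
        h a (Finset.mem_insert_self _ _), sub_self, zero_add] at h2
      rw [← h2]
      refine Finset.sum_congr rfl fun k hk => ?_
      rw [h k (Finset.mem_insert_of_mem hk), ← sub_smul]
      congr 1; ring
    have h3 : ∀ k ∈ F, f k = 0 := by
      intro k hk
      have := ih (fun k => (((k : ℕ) : ℂ) - ((a : ℕ) : ℂ)) • f k) (fun k hk => by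
        simp only [map_smul]
        rw [h k (Finset.mem_insert_of_mem hk), smul_comm]) h1 k hk
      refine (smul_eq_zero.mp this).resolve_left ?_
      rw [sub_eq_zero]
      intro h4
      have : k = a := PNat.coe_injective (by exact_mod_cast h4)
      exact ha (this ▸ hk)
    intro k hk
    rcases Finset.mem_insert.mp hk with rfl | hk
    · rw [Finset.sum_insert ha, Finset.sum_eq_zero h3, add_zero] at hs
      exact hs
    · exact h3 k hk

/-- vector-valued polynomials vanishing everywhere are zero -/
theorem poly_zero {M : Type*} [AddCommGroup M] [Module ℂ M] (n : ℕ) (v : ℕ → M)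
    (h : ∀ c : ℂ, ∑ i ∈ Finset.range n, c ^ i • v i = 0) : ∀ i < n, v i = 0 := by
  intro i hi
  rw [← Module.forall_dual_apply_eq_zero_iff ℂ]
  intro φ
  have h1 : (∑ j ∈ Finset.range n, Polynomial.C (φ (v j)) * Polynomial.X ^ j) = 0 := by
    refine Polynomial.funext fun c => ?_
    have := congrArg φ (h c)
    simp only [map_sum, map_smul, smul_eq_mul, map_zero] at this
    simp only [Polynomial.eval_finsetSum, Polynomial.eval_mul, Polynomial.eval_C,
      Polynomial.eval_pow, Polynomial.eval_X, Polynomial.eval_zero]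
    rw [← this]
    exact Finset.sum_congr rfl fun _ _ => mul_comm _ _
  have h2 := congrArg (fun p => Polynomial.coeff p i) h1
  simpa [Polynomial.finsetSum_coeff, Polynomial.coeff_C_mul, Polynomial.coeff_X_pow, hi] using h2

/-! ### The operator algebra -/

/-- `u ^ k φ` -/
def so (k : ℕ) (φ : Module.End ℂ (PolW W)) : Module.End ℂ (ℕ → PolW W) := Sh k * pt φ

theorem so_apply (k : ℕ) (φ : Module.End ℂ (PolW W)) (f : ℕ → PolW W) (m : ℕ) :
    so k φ f m = if k ≤ m then φ (f (m - k)) else 0 := rfl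

theorem so_mul (k l : ℕ) (φ ψ : Module.End ℂ (PolW W)) :
    so k φ * so l ψ = so (k + l) (φ * ψ) := by
  unfold so
  rw [mul_assoc, ← mul_assoc (pt φ), pt_Sh, mul_assoc, ← mul_assoc, Sh_mul, pt_mul]

theorem so_add (k : ℕ) (φ ψ : Module.End ℂ (PolW W)) : so k (φ + ψ) = so k φ + so k ψ := by
  unfold so; rw [pt_add, mul_add]

theorem so_smul (k : ℕ) (c : ℂ) (φ : Module.End ℂ (PolW W)) : so k (c • φ) = c • so k φ := by
  unfold so; rw [pt_smul, mul_smul_comm]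

theorem so_zero (k : ℕ) : so k (0 : Module.End ℂ (PolW W)) = 0 := by
  have := so_smul k (0 : ℂ) (0 : Module.End ℂ (PolW W))
  simpa using this

theorem th_so (k : ℕ) (φ : Module.End ℂ (PolW W)) :
    th * so k φ = so k φ * th + (k : ℂ) • so k φ := by
  unfold so
  rw [← mul_assoc, th_Sh, add_mul, mul_assoc, th_pt, mul_assoc, smul_mul_assoc]

theorem so_inj (k : ℕ) (φ : Module.End ℂ (PolW W)) (f : ℕ → PolW W) (h : so k φ f = 0) :
    pt φ f = 0 := Sh_inj k _ h

theorem pt_so (k : ℕ) (φ ψ : Module.End ℂ (PolW W)) : pt φ * so k ψ = so k (φ * ψ) := by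
  unfold so; rw [← mul_assoc, pt_Sh, mul_assoc, pt_mul]

theorem so_pt (k : ℕ) (φ ψ : Module.End ℂ (PolW W)) : so k φ * pt ψ = so k (φ * ψ) := by
  unfold so; rw [mul_assoc, pt_mul]

/-- `∂_l` in direction `(1, c)` -/
def dd (c : ℂ) (l : ℕ+) : Module.End ℂ (PolW W) := pdv (0, l) + c • pdv (1, l)

theorem dd_mulX (c : ℂ) (l i : ℕ+) :
    (dd c l * mulX (0, i) : Module.End ℂ (PolW W)) =
      mulX (0, i) * dd c l + if l = i then 1 else 0 := by
  unfold dd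
  rw [add_mul, smul_mul_assoc, pdv_mulX_ne (1, l) (0, i) (by simp), mul_add, mul_smul_comm]
  by_cases h : l = i
  · subst h; rw [pdv_mulX_self]; simp; abel
  · rw [pdv_mulX_ne _ _ (by simpa using h)]; simp [h]

theorem dd_pdv (c : ℂ) (l : ℕ+) (v : Fin 2 × ℕ+) :
    (dd c l * pdv v : Module.End ℂ (PolW W)) = pdv v * dd c l := by
  unfold dd
  rw [add_mul, mul_add, smul_mul_assoc, mul_smul_comm, pdv_comm, pdv_comm v (1, l)]

theorem dd_comm (c : ℂ) (l m : ℕ+) :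
    (dd c l * dd c m : Module.End ℂ (PolW W)) = dd c m * dd c l := by
  conv_lhs => rw [dd.eq_def c m]
  conv_rhs => rw [dd.eq_def c m]
  rw [add_mul, mul_add, smul_mul_assoc, mul_smul_comm, dd_pdv, dd_pdv]

/-- `D_q` truncated -/
def Dq (B : ℕ+) (q : Fin 2) : Module.End ℂ (ℕ → PolW W) :=
  ∑ l ∈ Finset.Icc 1 B, so l (pdv (q, l))

/-- `D` in direction `(1, c)` -/
def Dc (B : ℕ+) (c : ℂ) : Module.End ℂ (ℕ → PolW W) :=
  ∑ l ∈ Finset.Icc 1 B, so l (dd c l)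

/-- `T` in direction `(1, c)` -/
def Tc (B : ℕ+) (c : ℂ) : Module.End ℂ (ℕ → PolW W) :=
  ∑ l ∈ Finset.Icc 1 B, ∑ i ∈ Finset.Icc 1 B,
    if i < l then so ((l : ℕ) - (i : ℕ)) (mulX (0, i) * dd c l) else 0

/-- tail sums -/
def fc (B : ℕ+) (c : ℂ) (k : ℕ+) : Module.End ℂ (ℕ → PolW W) :=
  ∑ l ∈ Finset.Icc 1 B, if k ≤ l then so l (dd c l) else 0

theorem Dc_eq (B : ℕ+) (c : ℂ) : (Dc B c : Module.End ℂ (ℕ → PolW W)) = Dq B 0 + c • Dq B 1 := by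
  unfold Dc Dq dd
  rw [Finset.smul_sum, ← Finset.sum_add_distrib]
  simp only [so_add, so_smul]

theorem fc_one (B : ℕ+) (c : ℂ) : (fc B c 1 : Module.End ℂ (ℕ → PolW W)) = Dc B c := by
  unfold fc Dc; simp

theorem Dq_comm (B : ℕ+) (p q : Fin 2) :
    (Dq B p * Dq B q : Module.End ℂ (ℕ → PolW W)) = Dq B q * Dq B p := by
  unfold Dq
  rw [Finset.sum_mul_sum, Finset.sum_mul_sum, Finset.sum_comm]
  refine Finset.sum_congr rfl fun l _ => Finset.sum_congr rfl fun i _ => ?_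
  rw [so_mul, so_mul, add_comm, pdv_comm]

theorem e_T (B : ℕ+) (c : ℂ) (m : ℕ+) (hm : m ≤ B) :
    (so m (dd c m) * Tc B c : Module.End ℂ (ℕ → PolW W)) =
      Tc B c * so m (dd c m) + ∑ l ∈ Finset.Icc 1 B, if m < l then so l (dd c l) else 0 := by
  unfold Tc
  rw [Finset.mul_sum, Finset.sum_mul, ← Finset.sum_add_distrib]
  refine Finset.sum_congr rfl fun l _ => ?_
  rw [Finset.mul_sum, Finset.sum_mul]
  have : (if m < l then so (l : ℕ) (dd c l) else 0 : Module.End ℂ (ℕ → PolW W)) =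
      ∑ i ∈ Finset.Icc 1 B, if i = m then (if m < l then so (l : ℕ) (dd c l) else 0) else 0 := by
    rw [Finset.sum_ite_eq', if_pos (Finset.mem_Icc.mpr ⟨one_le, hm⟩)]
  rw [this, ← Finset.sum_add_distrib]
  refine Finset.sum_congr rfl fun i _ => ?_
  by_cases hil : i < l
  · have hil' : (i : ℕ) < l := hil
    rw [if_pos hil, so_mul, so_mul, ← mul_assoc, dd_mulX, add_mul, so_add]
    congr 1
    · rw [add_comm, mul_assoc, mul_assoc, dd_comm]
    · by_cases hmi : m = i
      · subst hmi; simp only [if_true, if_pos hil, one_mul]; congr 1; omega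
      · simp [hmi, Ne.symm hmi, so_zero]
  · rw [if_neg hil]
    by_cases hmi : i = m
    · subst hmi; simp [hil]
    · simp [hmi]

theorem key_comm (B : ℕ+) (c : ℂ) (k : ℕ+) :
    ((th + Tc B c) * fc B c k : Module.End ℂ (ℕ → PolW W)) =
      fc B c k * (th + Tc B c) + ((k : ℕ) : ℂ) • fc B c k := by
  have h1 : (th * fc B c k : Module.End ℂ (ℕ → PolW W)) =
      fc B c k * th + ∑ l ∈ Finset.Icc 1 B, if k ≤ l then ((l : ℕ) : ℂ) • so l (dd c l) else 0 := by
    unfold fc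
    rw [Finset.mul_sum, Finset.sum_mul, ← Finset.sum_add_distrib]
    refine Finset.sum_congr rfl fun l _ => ?_
    split_ifs
    · rw [th_so]
    · simp
  have h2 : (fc B c k * Tc B c : Module.End ℂ (ℕ → PolW W)) =
      Tc B c * fc B c k + ∑ l ∈ Finset.Icc 1 B,
        if k ≤ l then (((l : ℕ) : ℂ) - ((k : ℕ) : ℂ)) • so l (dd c l) else 0 := by
    have : (∑ l ∈ Finset.Icc 1 B,
        if k ≤ l then (((l : ℕ) : ℂ) - ((k : ℕ) : ℂ)) • so l (dd c l) else 0 :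
          Module.End ℂ (ℕ → PolW W)) = ∑ m ∈ Finset.Icc 1 B, if k ≤ m then
          ∑ l ∈ Finset.Icc 1 B, if m < l then so l (dd c l) else 0 else 0 := by
      have : ∀ m : ℕ+, (if k ≤ m then
          ∑ l ∈ Finset.Icc 1 B, if m < l then so l (dd c l) else 0 else 0 :
            Module.End ℂ (ℕ → PolW W)) = ∑ l ∈ Finset.Icc 1 B,
            if k ≤ m ∧ m < l then so l (dd c l) else 0 := by
        intro m
        by_cases h : k ≤ m <;> simp [h]
      simp only [this]
      rw [Finset.sum_comm]
      refine Finset.sum_congr rfl fun l hl => ?_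
      rw [← Finset.sum_filter, Finset.sum_const]
      have h3 : (Finset.filter (fun m => k ≤ m ∧ m < l) (Finset.Icc 1 B)) = Finset.Ico k l := by
        ext m
        simp only [Finset.mem_filter, Finset.mem_Icc, Finset.mem_Ico] at hl ⊢
        constructor
        · exact fun h => h.2
        · exact fun h => ⟨⟨one_le, h.2.le.trans hl.2⟩, h⟩
      rw [h3, PNat.card_Ico, ← Nat.cast_smul_eq_nsmul ℂ]
      split_ifs with h
      · rw [Nat.cast_sub (by exact_mod_cast h)]
      · rw [Nat.sub_eq_zero_of_le (by exact_mod_cast (not_le.mp h).le)]; simp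
    rw [this]
    unfold fc
    rw [Finset.mul_sum, Finset.sum_mul, ← Finset.sum_add_distrib]
    refine Finset.sum_congr rfl fun l hl => ?_
    split_ifs
    · rw [e_T _ _ _ (Finset.mem_Icc.mp hl).2]
    · simp
  rw [add_mul, mul_add, h1, h2]
  have h3 : ((k : ℕ) : ℂ) • (fc B c k : Module.End ℂ (ℕ → PolW W)) +
    (∑ l ∈ Finset.Icc 1 B,
        if k ≤ l then (((l : ℕ) : ℂ) - ((k : ℕ) : ℂ)) • so l (dd c l) else 0) =
    ∑ l ∈ Finset.Icc 1 B, if k ≤ l then ((l : ℕ) : ℂ) • so l (dd c l) else 0 := by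
    unfold fc
    rw [Finset.smul_sum, ← Finset.sum_add_distrib]
    refine Finset.sum_congr rfl fun l _ => ?_
    split_ifs
    · module
    · simp
  rw [← h3]; abel

/-- The sum of the tail operators is the commutator of theta with D. -/
theorem sum_fc (B : ℕ+) (c : ℂ) :
    (∑ k ∈ Finset.Icc 1 B, fc B c k : Module.End ℂ (ℕ → PolW W)) =
      th * Dc B c - Dc B c * th := by
  unfold fc Dc
  rw [Finset.sum_comm, Finset.mul_sum, Finset.sum_mul, ← Finset.sum_sub_distrib]
  refine Finset.sum_congr rfl fun l hl => ?_
  rw [th_so, add_sub_cancel_left, ← Finset.sum_filter, Finset.sum_const]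
  have h3 : (Finset.filter (fun m => m ≤ l) (Finset.Icc 1 B)) = Finset.Icc 1 l := by
    ext m
    simp only [Finset.mem_filter, Finset.mem_Icc] at hl ⊢
    constructor
    · exact fun h => ⟨h.1.1, h.2⟩
    · exact fun h => ⟨⟨h.1, h.2.trans hl.2⟩, h.2⟩
  rw [h3, PNat.card_Icc, ← Nat.cast_smul_eq_nsmul ℂ]
  simp

theorem fc_Dc (B : ℕ+) (c : ℂ) (k : ℕ+) :
    (fc B c k * Dc B c : Module.End ℂ (ℕ → PolW W)) = Dc B c * fc B c k := by
  unfold fc Dc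
  rw [Finset.sum_mul_sum, Finset.sum_mul_sum, Finset.sum_comm]
  refine Finset.sum_congr rfl fun l _ => Finset.sum_congr rfl fun i _ => ?_
  split_ifs
  · rw [so_mul, so_mul, add_comm, dd_comm]
  · simp

/-- The theta derivative of the powers of D. -/
theorem th_pow (B : ℕ+) (c : ℂ) (g : PolW W) (n : ℕ) :
    th ((Dc B c ^ (n + 1)) (io g)) =
      ((n : ℂ) + 1) • (∑ k ∈ Finset.Icc 1 B, fc B c k) ((Dc B c ^ n) (io g)) := by
  induction n with
  | zero =>
    rw [sum_fc]; simp [th_io]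
  | succ n ih =>
    have h1 : th ((Dc B c ^ (n + 1 + 1)) (io g)) =
        (∑ k ∈ Finset.Icc 1 B, fc B c k) ((Dc B c ^ (n + 1)) (io g))
          + Dc B c (th ((Dc B c ^ (n + 1)) (io g))) := by
      rw [sum_fc, pow_succ' _ (n + 1)]; simp
    have h2 : (∑ k ∈ Finset.Icc 1 B, fc B c k) ((Dc B c ^ (n + 1)) (io g)) =
        Dc B c ((∑ k ∈ Finset.Icc 1 B, fc B c k) ((Dc B c ^ n) (io g))) := by
      rw [pow_succ']
      simp only [← Module.End.mul_apply, ← mul_assoc]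
      rw [Finset.sum_mul, Finset.mul_sum]
      simp only [fc_Dc]
    rw [h1, ih, map_smul, ← h2]
    push_cast
    module

/-- moving `T` to the left -/
theorem Dpow_T (B : ℕ+) (c : ℂ) (g : PolW W) (n : ℕ) :
    (Dc B c ^ n) (Tc B c (io g)) = (th + Tc B c : Module.End ℂ (ℕ → PolW W)) ((Dc B c ^ n) (io g))
      - (n : ℂ) • (Dc B c ^ n) (io g) := by
  induction n with
  | zero => simp [th_io]
  | succ n ih =>
    have h := key_comm (W := W) B c 1
    rw [fc_one] at h
    have h1 := LinearMap.congr_fun h ((Dc B c ^ n) (io g))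
    rw [pow_succ', Module.End.mul_apply, ih, map_sub, map_smul]
    simp only [Module.End.mul_apply, LinearMap.add_apply (Dc B c * _), LinearMap.smul_apply] at h1 ⊢
    rw [h1]
    push_cast
    module

/-! ### Euler operator -/

/-- truncated Euler operator -/
def eu (B : ℕ+) : Module.End ℂ (PolW W) :=
  ∑ q : Fin 2, ∑ k ∈ Finset.Icc 1 B, mulX (q, k) * pdv (q, k)

theorem eu_apply (B : ℕ+) (f : PolW W) (μ : (Fin 2 × ℕ+) →₀ ℕ) :
    eu B f μ = ((∑ q : Fin 2, ∑ k ∈ Finset.Icc 1 B, μ (q, k) : ℕ) : ℂ) • f μ := by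
  unfold eu
  simp only [LinearMap.sum_apply, Finsupp.finsetSum_apply, Module.End.mul_apply, mulX_pdv_apply]
  push_cast
  simp only [Finset.sum_smul]

theorem eu_neg (B : ℕ+) (f : PolW W) (h : eu B f = -f) : f = 0 := by
  ext μ
  have h1 := DFunLike.congr_fun h μ
  rw [eu_apply] at h1
  have h2 : ((∑ q : Fin 2, ∑ k ∈ Finset.Icc 1 B, μ (q, k) : ℕ) + 1 : ℂ) • f μ = 0 := by
    rw [add_smul, h1]; simp
  exact (smul_eq_zero.mp h2).resolve_left (Nat.cast_add_one_ne_zero _)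

theorem pdv_eu (B : ℕ+) (q : Fin 2) (l : ℕ+) (hl : l ≤ B) :
    (pdv (q, l) * eu B : Module.End ℂ (PolW W)) = eu B * pdv (q, l) + pdv (q, l) := by
  unfold eu
  have h0 : (pdv (q, l) : Module.End ℂ (PolW W)) =
      ∑ p : Fin 2, ∑ k ∈ Finset.Icc 1 B,
        if p = q then (if k = l then pdv (q, l) else 0) else 0 := by
    have : ∀ p : Fin 2, (∑ k ∈ Finset.Icc 1 B,
        if p = q then (if k = l then pdv (q, l) else 0) else 0 : Module.End ℂ (PolW W)) =
        if p = q then pdv (q, l) else 0 := by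
      intro p
      by_cases h : p = q
      · simp only [h, if_true]
        rw [Finset.sum_ite_eq', if_pos (Finset.mem_Icc.mpr ⟨one_le, hl⟩)]
      · simp [h]
    simp only [this]
    rw [Finset.sum_ite_eq', if_pos (Finset.mem_univ _)]
  rw [Finset.mul_sum, Finset.sum_mul]
  conv_rhs => arg 2; rw [h0]
  rw [← Finset.sum_add_distrib]
  refine Finset.sum_congr rfl fun p _ => ?_
  rw [Finset.mul_sum, Finset.sum_mul, ← Finset.sum_add_distrib]
  refine Finset.sum_congr rfl fun k _ => ?_
  by_cases h : (q, l) = (p, k)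
  · obtain ⟨rfl, rfl⟩ := Prod.mk.inj h
    rw [← mul_assoc, pdv_mulX_self]
    simp [add_mul]
  · rw [← mul_assoc, pdv_mulX_ne _ _ h, mul_assoc, pdv_comm, mul_assoc]
    have : (if p = q then (if k = l then pdv (q, l) else 0) else 0 : Module.End ℂ (PolW W)) = 0 := by
      split_ifs with h1 h2
      · subst h1 h2; exact absurd rfl h
      · rfl
      · rfl
    rw [this, add_zero]

theorem dd_eu (B : ℕ+) (c : ℂ) (l : ℕ+) (hl : l ≤ B) :
    (dd c l * eu B : Module.End ℂ (PolW W)) = eu B * dd c l + dd c l := by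
  unfold dd
  rw [add_mul, mul_add, smul_mul_assoc, mul_smul_comm, pdv_eu _ _ _ hl, pdv_eu _ _ _ hl]
  module

theorem Dc_eu (B : ℕ+) (c : ℂ) :
    (pt (eu B) * Dc B c : Module.End ℂ (ℕ → PolW W)) = Dc B c * pt (eu B) - Dc B c := by
  unfold Dc
  rw [Finset.mul_sum, Finset.sum_mul, ← Finset.sum_sub_distrib]
  refine Finset.sum_congr rfl fun l hl => ?_
  rw [pt_so, so_pt, dd_eu _ _ _ (Finset.mem_Icc.mp hl).2, so_add, add_sub_cancel_right]

theorem eu_pow (B : ℕ+) (c : ℂ) (g : PolW W) (ℓ : ℕ) (hg : eu B g = (ℓ : ℂ) • g) (n : ℕ) :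
    pt (eu B) ((Dc B c ^ n) (io g)) = ((ℓ : ℂ) - n) • (Dc B c ^ n) (io g) := by
  induction n with
  | zero =>
    ext1 m
    by_cases h : m = 0 <;> simp [pt_apply, io, h, hg]
  | succ n ih =>
    have h := LinearMap.congr_fun (Dc_eu (W := W) B c) ((Dc B c ^ n) (io g))
    simp only [Module.End.mul_apply, LinearMap.sub_apply, ih, map_smul] at h
    rw [pow_succ', Module.End.mul_apply, h]
    push_cast
    module

theorem Dc_apply (B : ℕ+) (c : ℂ) (f : ℕ → PolW W) (m : ℕ) :
    Dc B c f m = ∑ l ∈ Finset.Icc 1 B, if (l : ℕ) ≤ m then dd c l (f (m - l)) else 0 := by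
  simp [Dc, LinearMap.sum_apply, Finset.sum_apply, so_apply]

theorem Dq_apply (B : ℕ+) (q : Fin 2) (f : ℕ → PolW W) (m : ℕ) :
    Dq B q f m = ∑ l ∈ Finset.Icc 1 B, if (l : ℕ) ≤ m then pdv (q, l) (f (m - l)) else 0 := by
  simp [Dq, LinearMap.sum_apply, Finset.sum_apply, so_apply]

theorem Dpow_low (B : ℕ+) (c : ℂ) (g : PolW W) (n : ℕ) :
    ∀ m < n, (Dc B c ^ n) (io g) m = 0 := by
  induction n with
  | zero => intro m hm; omega
  | succ n ih =>
    intro m hm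
    rw [pow_succ', Module.End.mul_apply, Dc_apply]
    refine Finset.sum_eq_zero fun l _ => ?_
    split_ifs with h
    · have := l.pos
      rw [ih _ (by omega), map_zero]
    · rfl

theorem Tc_zero (B : ℕ+) (c : ℂ) (f : ℕ → PolW W) : Tc B c f 0 = 0 := by
  unfold Tc
  simp only [LinearMap.sum_apply, Finset.sum_apply]
  refine Finset.sum_eq_zero fun l _ => Finset.sum_eq_zero fun i _ => ?_
  split_ifs with h
  · have h' : (i : ℕ) < l := h
    rw [so_apply, if_neg (by omega)]
  · rfl

theorem Tc_eq_zero (B : ℕ+) (c : ℂ) (f : ℕ → PolW W)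
    (h : ∀ l ≤ B, pt (dd c l) f = 0) : Tc B c f = 0 := by
  unfold Tc
  simp only [LinearMap.sum_apply]
  refine Finset.sum_eq_zero fun l hl => Finset.sum_eq_zero fun i _ => ?_
  split_ifs
  · rw [← so_pt, Module.End.mul_apply, h l (Finset.mem_Icc.mp hl).2, map_zero]
  · rfl

theorem rho_so (E : Module.End ℂ W) (k : ℕ) (q : Fin 2) (l : ℕ+) :
    pt (rhoOp E) * so k (pdv (q, l)) = so k (pdv (q, l)) * pt (rhoOp E) := by
  rw [pt_so, so_pt, rhoOp_pdv]

theorem rho_so_dd (E : Module.End ℂ W) (k : ℕ) (c : ℂ) (l : ℕ+) :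
    pt (rhoOp E) * so k (dd c l) = so k (dd c l) * pt (rhoOp E) := by
  unfold dd
  rw [so_add, so_smul, mul_add, add_mul, mul_smul_comm, smul_mul_assoc, rho_so, rho_so]

theorem rho_Dc (E : Module.End ℂ W) (B : ℕ+) (c : ℂ) :
    pt (rhoOp E) * Dc B c = Dc B c * pt (rhoOp E) := by
  unfold Dc
  rw [Finset.mul_sum, Finset.sum_mul]
  exact Finset.sum_congr rfl fun l _ => rho_so_dd _ _ _ _

theorem rho_fc (E : Module.End ℂ W) (B : ℕ+) (c : ℂ) (k : ℕ+) :
    pt (rhoOp E) * fc B c k = fc B c k * pt (rhoOp E) := by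
  unfold fc
  rw [Finset.mul_sum, Finset.sum_mul]
  refine Finset.sum_congr rfl fun l _ => ?_
  split_ifs
  · exact rho_so_dd _ _ _ _
  · simp

/-- `h` is killed by all derivatives -/
theorem step_deriv (B : ℕ+) (c : ℂ) (E : Module.End ℂ W) (b : ℂ) (h : ℕ → PolW W)
    (h1 : pt (rhoOp E) h + (th + Tc B c : Module.End ℂ (ℕ → PolW W)) h = b • h)
    (h2 : (∑ k ∈ Finset.Icc 1 B, fc B c k) h = 0) (h3 : Dq B 1 h = 0) :
    ∀ q, ∀ l ≤ B, pt (pdv (q, l)) h = 0 := by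
  have hf : ∀ k ∈ Finset.Icc 1 B, fc B c k h = 0 := by
    refine eig_indep (pt (rhoOp E) + (th + Tc B c)) b _ (fun k => fc B c k h) ?_ ?_
    · intro k _
      have e1 := LinearMap.congr_fun (key_comm (W := W) B c k) h
      have e2 := LinearMap.congr_fun (rho_fc E B c k) h
      have e3 := congrArg (fc B c k) h1
      simp only [Module.End.mul_apply, LinearMap.add_apply (fc B c k * _), LinearMap.smul_apply,
        map_smul, map_add (fc B c k)] at e1 e2 e3
      rw [LinearMap.add_apply, e1, e2, add_smul, ← e3, add_assoc]
    · simpa [LinearMap.sum_apply] using h2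
  have he : ∀ l ≤ B, pt (dd c l) h = 0 := by
    intro l hl
    apply so_inj l
    have hl1 := hf l (Finset.mem_Icc.mpr ⟨one_le, hl⟩)
    have hsplit : (fc B c l : Module.End ℂ (ℕ → PolW W)) = so l (dd c l) + fc B c (l + 1) := by
      unfold fc
      have : (so (l : ℕ) (dd c l) : Module.End ℂ (ℕ → PolW W)) =
          ∑ i ∈ Finset.Icc 1 B, if i = l then so (i : ℕ) (dd c i) else 0 := by
        rw [Finset.sum_ite_eq', if_pos (Finset.mem_Icc.mpr ⟨one_le, hl⟩)]
      rw [this, ← Finset.sum_add_distrib]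
      refine Finset.sum_congr rfl fun i _ => ?_
      rcases lt_trichotomy i l with h | h | h
      · rw [if_neg (not_le.mpr h), if_neg h.ne, if_neg, add_zero]
        exact not_le.mpr (h.trans (PNat.lt_add_right l 1))
      · subst h
        rw [if_pos le_rfl, if_pos rfl, if_neg (not_le.mpr (PNat.lt_add_right i 1)), add_zero]
      · rw [if_pos h.le, if_neg h.ne', if_pos (PNat.add_one_le_iff.mpr h), zero_add]
    have hl2 : fc B c (l + 1) h = 0 := by
      by_cases hB : l + 1 ≤ B
      · exact hf _ (Finset.mem_Icc.mpr ⟨one_le, hB⟩)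
      · unfold fc
        rw [Finset.sum_eq_zero]
        · simp
        · intro i hi
          rw [if_neg]
          exact fun h => hB (h.trans (Finset.mem_Icc.mp hi).2)
    rw [hsplit, LinearMap.add_apply, hl2, add_zero] at hl1
    exact hl1
  have hT := Tc_eq_zero B c h he
  have h1' : pt (rhoOp E) h + th h = b • h := by
    rw [← h1, LinearMap.add_apply, hT, add_zero]
  have hg : ∀ k ∈ Finset.Icc 1 B, so k (pdv (1, k)) h = 0 := by
    refine eig_indep (pt (rhoOp E) + th) b _ (fun k : ℕ+ => so k (pdv (1, k)) h) ?_ ?_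
    · intro k _
      have e1 := LinearMap.congr_fun (th_so (W := W) k (pdv (1, k))) h
      have e2 := LinearMap.congr_fun (rho_so E k 1 k) h
      have e3 := congrArg (so (k : ℕ) (pdv (1, k))) h1'
      simp only [Module.End.mul_apply, LinearMap.add_apply, LinearMap.smul_apply,
        map_smul, map_add] at e1 e2 e3
      rw [LinearMap.add_apply, e1, e2, add_smul, ← e3, add_assoc]
    · simpa [Dq, LinearMap.sum_apply] using h3
  have hp1 : ∀ l ≤ B, pt (pdv (1, l)) h = 0 := fun l hl =>
    so_inj l _ _ (hg l (Finset.mem_Icc.mpr ⟨one_le, hl⟩))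
  intro q l hl
  fin_cases q
  · have := he l hl
    unfold dd at this
    rw [pt_add, pt_smul, LinearMap.add_apply, LinearMap.smul_apply, hp1 l hl, smul_zero,
      add_zero] at this
    exact this
  · exact hp1 l hl

theorem eu_zero_of (B : ℕ+) (h : ℕ → PolW W) (hd : ∀ q, ∀ l ≤ B, pt (pdv (q, l)) h = 0) :
    pt (eu B) h = 0 := by
  ext1 m
  rw [pt_apply]
  unfold eu
  simp only [LinearMap.sum_apply, Module.End.mul_apply]
  refine Finset.sum_eq_zero fun q _ => Finset.sum_eq_zero fun l hl => ?_
  have := congrFun (hd q l (Finset.mem_Icc.mp hl).2) m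
  rw [pt_apply] at this
  rw [this]; simp

theorem eu_zero_imp (B : ℕ+) (h : ℕ → PolW W) (hh : pt (eu B) h = 0) :
    ∀ q, ∀ l ≤ B, pt (pdv (q, l)) h = 0 := by
  intro q l hl
  ext1 m
  apply eu_neg B
  have e1 := LinearMap.congr_fun (pdv_eu (W := W) B q l hl) (h m)
  have e2 := congrFun hh m
  rw [pt_apply] at e2
  simp only [Module.End.mul_apply, LinearMap.add_apply] at e1
  rw [e2] at e1
  rw [pt_apply, eq_neg_iff_add_eq_zero, ← e1]; simp

/-- polarization -/
theorem polar (B : ℕ+) (g : PolW W) (n : ℕ)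
    (h : ∀ c, (Dc B c ^ (n + 1)) (io g) = 0) (c : ℂ) : Dq B 1 ((Dc B c ^ n) (io g)) = 0 := by
  have hexp : ∀ (c : ℂ) (n : ℕ), (Dc B c ^ n : Module.End ℂ (ℕ → PolW W)) =
      ∑ i ∈ Finset.range (n + 1), c ^ i • ((n.choose i : ℂ) • (Dq B 1 ^ i * Dq B 0 ^ (n - i))) := by
    intro c n
    have hc : Commute (c • Dq B 1) (Dq B 0 : Module.End ℂ (ℕ → PolW W)) := by
      show _ * _ = _ * _
      rw [smul_mul_assoc, mul_smul_comm, Dq_comm]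
    rw [Dc_eq, add_comm, hc.add_pow]
    refine Finset.sum_congr rfl fun i _ => ?_
    rw [smul_pow, smul_mul_assoc, smul_mul_assoc, ← Nat.cast_comm, ← nsmul_eq_mul,
      Nat.cast_smul_eq_nsmul]
  have hz : ∀ i < n + 2, ((n + 1).choose i : ℂ) • (Dq B 1 ^ i * Dq B 0 ^ (n + 1 - i) :
      Module.End ℂ (ℕ → PolW W)) (io g) = 0 := by
    apply poly_zero
    intro c
    have := h c
    rw [hexp] at this
    simpa only [LinearMap.sum_apply, LinearMap.smul_apply] using this
  rw [hexp]
  simp only [LinearMap.sum_apply, map_sum, LinearMap.smul_apply, map_smul]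
  refine Finset.sum_eq_zero fun i hi => ?_
  have hi' := Finset.mem_range.mp hi
  have h1 := hz (i + 1) (by omega)
  rw [show n + 1 - (i + 1) = n - i by omega] at h1
  have h2 := (smul_eq_zero.mp h1).resolve_left
    (by exact_mod_cast (Nat.choose_pos (by omega)).ne')
  rw [pow_succ', mul_assoc, Module.End.mul_apply] at h2
  rw [h2]; simp

theorem abstract_main (B B' : ℕ+) (hBB : B ≤ B') (g : PolW W) (ℓ : ℕ) (hℓ : 2 ≤ ℓ)
    (hEu : eu B g = (ℓ : ℂ) • g) (A : ℂ → Module.End ℂ W)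
    (hE : ∀ (c : ℂ) (n j : ℕ), n ≤ ℓ → 1 ≤ j →
      (((n : ℂ) + 1)⁻¹ • ∑ i ∈ Finset.Icc 1 B', mulX (0, i) ((Dc B c ^ (n + 1)) (io g) (i + j)) :
        PolW W) =
      pt (rhoOp (A c)) ((Dc B c ^ n) (io g)) j + (Dc B c ^ n) (Tc B c (io g)) j) : g = 0 := by
  -- equation in case `D^{n+1} g = 0`
  have hE0 : ∀ (c : ℂ) (n : ℕ), n ≤ ℓ → 1 ≤ n → (Dc B c ^ (n + 1)) (io g) = 0 →
      pt (rhoOp (A c)) ((Dc B c ^ n) (io g)) +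
        (th + Tc B c : Module.End ℂ (ℕ → PolW W)) ((Dc B c ^ n) (io g)) =
        (n : ℂ) • (Dc B c ^ n) (io g) := by
    intro c n hn hn1 h0
    ext1 j
    rcases Nat.eq_zero_or_pos j with rfl | hj
    · have := Dpow_low B c g n 0 hn1
      simp [pt_apply, this, th_apply, Tc_zero]
    · have := hE c n j hn hj
      rw [h0, Dpow_T] at this
      simp only [Pi.zero_apply, map_zero, Finset.sum_const_zero, smul_zero, Pi.sub_apply] at this
      rw [← add_sub_assoc, eq_comm, sub_eq_zero] at this
      exact this
  -- top
  have hS1 : ∀ c, (Dc B c ^ (ℓ + 1)) (io g) = 0 := by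
    intro c
    ext1 m
    apply eu_neg B
    have := congrFun (eu_pow B c g ℓ hEu (ℓ + 1)) m
    rw [pt_apply] at this
    rw [this]
    push_cast
    simp
  have hS0 : ∀ c, (Dc B c ^ ℓ) (io g) = 0 := by
    intro c
    have hA := hE0 c ℓ le_rfl (by omega) (hS1 c)
    obtain ⟨n, rfl⟩ : ∃ n, ℓ = n + 1 := ⟨ℓ - 1, by omega⟩
    have hd := eu_zero_imp B ((Dc B c ^ (n + 1)) (io g)) (by rw [eu_pow B c g _ hEu]; simp)
    have hdd : ∀ l ≤ B, ∀ m, dd c l ((Dc B c ^ (n + 1)) (io g) m) = 0 := by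
      intro l hl m
      have e0 := congrFun (hd 0 l hl) m
      have e1 := congrFun (hd 1 l hl) m
      rw [pt_apply] at e0 e1
      simp [dd, e0, e1]
    -- the sequence Ξ h
    let Xi : ℕ → PolW W := fun j => if j = 0 then 0 else
      ∑ i ∈ Finset.Icc 1 B', mulX (0, i) ((Dc B c ^ (n + 1)) (io g) (i + j))
    have hXi : ((n : ℂ) + 1)⁻¹ • Xi = pt (rhoOp (A c)) ((Dc B c ^ n) (io g)) +
        (th + Tc B c : Module.End ℂ (ℕ → PolW W)) ((Dc B c ^ n) (io g)) -
        (n : ℂ) • (Dc B c ^ n) (io g) := by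
      ext1 j
      rcases Nat.eq_zero_or_pos j with rfl | hj
      · have := Dpow_low B c g n 0 (by omega)
        simp [pt_apply, this, th_apply, Tc_zero, Xi]
      · have := hE c n j (by omega) hj
        rw [Dpow_T] at this
        simp only [Pi.smul_apply, Xi, if_neg hj.ne']
        rw [this, add_sub_assoc]
        rfl
    have hDXi : Dc B c Xi = 0 := by
      have h := congrArg (Dc B c) hXi
      have e1 := LinearMap.congr_fun (key_comm (W := W) B c 1) ((Dc B c ^ n) (io g))
      have e2 := LinearMap.congr_fun (rho_Dc (A c) B c) ((Dc B c ^ n) (io g))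
      rw [fc_one] at e1
      simp only [Module.End.mul_apply, LinearMap.add_apply (Dc B c * _), LinearMap.smul_apply,
        map_smul, map_add (Dc B c), map_sub] at e1 e2 h
      have e3 : Dc B c ((Dc B c ^ n) (io g)) = (Dc B c ^ (n + 1)) (io g) := by
        rw [pow_succ', Module.End.mul_apply]
      rw [e3] at e1 e2 h
      rw [← e2] at h
      rw [e1] at hA
      have h4 : ((n : ℂ) + 1)⁻¹ • Dc B c Xi = 0 := by
        rw [h]
        push_cast at hA
        rw [← add_assoc] at hA
        rw [← eq_sub_iff_add_eq] at hA
        rw [hA]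
        module
      exact (smul_eq_zero.mp h4).resolve_left
        (inv_ne_zero (by exact_mod_cast Nat.succ_ne_zero n))
    ext1 m
    by_cases hm : m < 2
    · exact Dpow_low B c g (n + 1) m (by omega)
    have hm2 := congrFun hDXi m
    rw [Dc_apply] at hm2
    have hterm : ∀ l ∈ Finset.Icc 1 B, (if (l : ℕ) ≤ m then dd c l (Xi (m - l)) else 0) =
        if (l : ℕ) < m then (Dc B c ^ (n + 1)) (io g) m else 0 := by
      intro l hl
      have hlB := (Finset.mem_Icc.mp hl).2
      by_cases h1 : (l : ℕ) < m
      · rw [if_pos h1.le, if_pos h1]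
        simp only [Xi, if_neg (show m - (l : ℕ) ≠ 0 by omega), map_sum]
        rw [Finset.sum_eq_single l]
        · rw [← Module.End.mul_apply, dd_mulX, if_pos rfl]
          simp only [LinearMap.add_apply, Module.End.mul_apply, hdd l hlB, map_zero, zero_add,
            Module.End.one_apply]
          rw [show (l : ℕ) + (m - l) = m by omega]
        · intro i _ hi
          rw [← Module.End.mul_apply, dd_mulX, if_neg (Ne.symm hi)]
          simp [hdd l hlB]
        · intro h
          exact absurd (Finset.mem_Icc.mpr ⟨one_le, hlB.trans hBB⟩) h
      · rw [if_neg h1]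
        split_ifs with h2
        · have : m - (l : ℕ) = 0 := by omega
          simp [Xi, this]
        · rfl
    rw [Finset.sum_congr rfl hterm, ← Finset.sum_filter, Finset.sum_const,
      ← Nat.cast_smul_eq_nsmul ℂ] at hm2
    refine (smul_eq_zero.mp hm2).resolve_left ?_
    have : (Finset.filter (fun l : ℕ+ => (l : ℕ) < m) (Finset.Icc 1 B)).Nonempty :=
      ⟨1, by simp; omega⟩
    exact_mod_cast this.card_pos.ne'
  have hS : ∀ k, k < ℓ → ∀ c, (Dc B c ^ (ℓ - k)) (io g) = 0 := by
    intro k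
    induction k with
    | zero => intro _; exact hS0
    | succ k ih =>
      intro hk c
      have ih' := ih (by omega)
      obtain ⟨n, hn⟩ : ∃ n, ℓ - (k + 1) = n := ⟨_, rfl⟩
      rw [show ℓ - k = n + 1 by omega] at ih'
      rw [hn]
      have hA := hE0 c n (by omega) (by omega) (ih' c)
      have h2 : (∑ k ∈ Finset.Icc 1 B, fc B c k) ((Dc B c ^ n) (io g)) = 0 := by
        have := th_pow B c g n
        rw [ih' c, map_zero, eq_comm] at this
        exact (smul_eq_zero.mp this).resolve_left (by exact_mod_cast Nat.succ_ne_zero n)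
      have hd := step_deriv B c (A c) _ _ hA h2 (polar B g n ih' c)
      have he := eu_zero_of B _ hd
      rw [eu_pow B c g ℓ hEu, smul_eq_zero] at he
      refine he.resolve_left ?_
      rw [sub_eq_zero]
      intro h
      have : ℓ = n := by exact_mod_cast h
      omega
  have hfin := hS (ℓ - 1) (by omega)
  rw [show ℓ - (ℓ - 1) = 0 + 1 by omega] at hfin
  have hq1 := polar B g 0 hfin 0
  have hq0 := hfin 0
  rw [Dc_eq] at hq0
  simp only [zero_add, pow_one, zero_smul, add_zero, pow_zero, Module.End.one_apply] at hq0 hq1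
  have hq : ∀ q, ∀ l ≤ B, pdv (q, l) g = 0 := by
    intro q l hl
    have h : Dq B q (io g) = 0 := by fin_cases q <;> assumption
    have h1 := congrFun h l
    rw [Dq_apply, Finset.sum_eq_single l] at h1
    · simpa [io] using h1
    · intro i _ hi
      split_ifs with h2
      · have : (l : ℕ) - i ≠ 0 := by
          intro h3
          exact hi (PNat.coe_injective (by omega))
        simp [io, this]
      · rfl
    · intro h
      exact absurd (Finset.mem_Icc.mpr ⟨one_le, hl⟩) h
  have h0 : eu B g = 0 := by
    unfold eu
    simp only [LinearMap.sum_apply, Module.End.mul_apply]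
    refine Finset.sum_eq_zero fun q _ => Finset.sum_eq_zero fun l hl => ?_
    rw [hq q l (Finset.mem_Icc.mp hl).2, map_zero]
  rw [hEu, smul_eq_zero] at h0
  refine h0.resolve_left ?_
  exact_mod_cast (by omega : ℓ ≠ 0)

/-! ### Connection with the frozen definitions -/

/-- `D_q` as a power series with operator coefficients -/
def ps (q : Fin 2) : PowerSeries (Module.End ℂ (PolW W)) :=
  PowerSeries.mk fun j => if h : 0 < j then pdv (q, ⟨j, h⟩) else 0

theorem Fop_eq (p : Fin 2) (t m : ℕ) :
    (Fop2 p t m : Module.End ℂ (PolW W)) = PowerSeries.coeff m (ps p ^ t) := by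
  induction t generalizing m with
  | zero => simp [Fop2, PowerSeries.coeff_one]
  | succ t ih =>
    rw [Fop2, pow_succ', PowerSeries.coeff_mul,
      Finset.Nat.sum_antidiagonal_eq_sum_range_succ
        (fun a b => (PowerSeries.coeff a (ps p) * PowerSeries.coeff b (ps p ^ t) :
          Module.End ℂ (PolW W)))]
    have h1 : ∀ j ∈ (Finset.Icc 1 m).attach,
        (pdv (p, ⟨j.1, by have := (Finset.mem_Icc.mp j.2).1; omega⟩) ∘ₗ Fop2 p t (m - j.1) :
          Module.End ℂ (PolW W)) =
        (fun a => (PowerSeries.coeff a (ps p) * PowerSeries.coeff (m - a) (ps p ^ t) :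
          Module.End ℂ (PolW W))) j.1 := by
      intro j _
      have hj : 0 < j.1 := (Finset.mem_Icc.mp j.2).1
      simp only [ps, PowerSeries.coeff_mk, dif_pos hj]
      rw [ih]; rfl
    rw [Finset.sum_congr rfl h1, Finset.sum_attach (Finset.Icc 1 m)
      (fun a => (PowerSeries.coeff a (ps p) * PowerSeries.coeff (m - a) (ps p ^ t) :
          Module.End ℂ (PolW W)))]
    refine Finset.sum_subset (fun x hx => ?_) (fun x hx hx' => ?_)
    · simp only [Finset.mem_Icc, Finset.mem_range] at hx ⊢; omega
    · have : x = 0 := by simp only [Finset.mem_Icc, Finset.mem_range] at hx hx'; omega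
      subst this
      simp [ps]

/-- action of operator power series on sequences -/
def act (φ : PowerSeries (Module.End ℂ (PolW W))) (f : ℕ → PolW W) : ℕ → PolW W :=
  fun m => ∑ x ∈ Finset.HasAntidiagonal.antidiagonal m, PowerSeries.coeff x.1 φ (f x.2)

theorem act_one (f : ℕ → PolW W) : act 1 f = f := by
  ext1 m
  unfold act
  rw [Finset.sum_eq_single (0, m)]
  · simp
  · intro x hx hne
    have : x.1 ≠ 0 := by
      intro h
      apply hne
      rw [Finset.HasAntidiagonal.mem_antidiagonal] at hx
      ext <;> simp <;> omega
    simp [PowerSeries.coeff_one, this]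
  · simp

theorem triple_aux {M : Type*} [AddCommMonoid M] (m : ℕ) (F : ℕ → ℕ → ℕ → M) :
    ∑ x ∈ Finset.HasAntidiagonal.antidiagonal m,
      ∑ y ∈ Finset.HasAntidiagonal.antidiagonal x.1, F y.1 y.2 x.2 =
    ∑ x ∈ Finset.HasAntidiagonal.antidiagonal m,
      ∑ y ∈ Finset.HasAntidiagonal.antidiagonal x.2, F x.1 y.1 y.2 := by
  rw [Finset.sum_sigma', Finset.sum_sigma']
  refine Finset.sum_nbij' (fun z => ⟨(z.2.1, z.2.2 + z.1.2), (z.2.2, z.1.2)⟩)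
    (fun z => ⟨(z.1.1 + z.2.1, z.2.2), (z.1.1, z.2.1)⟩) ?_ ?_ ?_ ?_ ?_
  · rintro ⟨⟨a, b⟩, ⟨c, d⟩⟩ h
    simp only [Finset.mem_sigma, Finset.HasAntidiagonal.mem_antidiagonal] at h ⊢
    refine ⟨?_, ?_⟩ <;> first | trivial | omega
  · rintro ⟨⟨a, b⟩, ⟨c, d⟩⟩ h
    simp only [Finset.mem_sigma, Finset.HasAntidiagonal.mem_antidiagonal] at h ⊢
    refine ⟨?_, ?_⟩ <;> first | trivial | omega
  · rintro ⟨⟨a, b⟩, ⟨c, d⟩⟩ h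
    simp only [Finset.mem_sigma, Finset.HasAntidiagonal.mem_antidiagonal] at h
    obtain ⟨h1, rfl⟩ := h
    rfl
  · rintro ⟨⟨a, b⟩, ⟨c, d⟩⟩ h
    simp only [Finset.mem_sigma, Finset.HasAntidiagonal.mem_antidiagonal] at h
    obtain ⟨h1, rfl⟩ := h
    rfl
  · rintro ⟨⟨a, b⟩, ⟨c, d⟩⟩ h
    rfl

theorem act_mul (φ ψ : PowerSeries (Module.End ℂ (PolW W))) (f : ℕ → PolW W) :
    act (φ * ψ) f = act φ (act ψ f) := by
  ext1 m
  unfold act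
  simp only [PowerSeries.coeff_mul, LinearMap.sum_apply, map_sum, Module.End.mul_apply]
  exact triple_aux m
    (fun a b c => (PowerSeries.coeff a φ) ((PowerSeries.coeff b ψ) (f c)))

theorem act_io (φ : PowerSeries (Module.End ℂ (PolW W))) (g : PolW W) (m : ℕ) :
    act φ (io g) m = PowerSeries.coeff m φ g := by
  unfold act
  rw [Finset.sum_eq_single (m, 0)]
  · simp [io]
  · intro x hx hne
    have : x.2 ≠ 0 := by
      intro h
      apply hne
      rw [Finset.HasAntidiagonal.mem_antidiagonal] at hx
      ext <;> simp <;> omega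
    simp [io, this]
  · simp

/-- all variables occurring have index at most `B` -/
def Good (B : ℕ+) (f : ℕ → PolW W) : Prop := ∀ m q, ∀ l, B < l → pdv (q, l) (f m) = 0

theorem good_Dq (B : ℕ+) (q : Fin 2) (f : ℕ → PolW W) (hf : Good B f) : Good B (Dq B q f) := by
  intro m p l hl
  rw [Dq_apply, map_sum]
  refine Finset.sum_eq_zero fun k _ => ?_
  split_ifs
  · rw [← Module.End.mul_apply, pdv_comm, Module.End.mul_apply, hf _ _ _ hl, map_zero]
  · simp

theorem act_ps (B : ℕ+) (q : Fin 2) (f : ℕ → PolW W) (hf : Good B f) :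
    act (ps q) f = Dq B q f := by
  ext1 m
  rw [Dq_apply]
  unfold act
  rw [Finset.Nat.sum_antidiagonal_eq_sum_range_succ
    (fun a b => (PowerSeries.coeff a (ps q) : Module.End ℂ (PolW W)) (f b)), ← Finset.sum_filter]
  symm
  refine Finset.sum_of_injOn (fun l : ℕ+ => (l : ℕ)) ?_ ?_ ?_ ?_
  · intro a _ b _ h
    exact PNat.coe_injective h
  · intro a ha
    simp only [Finset.coe_filter, Set.mem_setOf_eq, Finset.coe_range, Set.mem_Iio] at ha ⊢
    omega
  · intro x hx hx'
    rcases Nat.eq_zero_or_pos x with rfl | hpos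
    · simp [ps]
    · simp only [ps, PowerSeries.coeff_mk, dif_pos hpos]
      refine hf _ _ _ ?_
      by_contra hB
      apply hx'
      refine ⟨⟨x, hpos⟩, ?_, rfl⟩
      simp only [Finset.coe_filter, Set.mem_setOf_eq, Finset.mem_Icc, Finset.mem_range] at hx ⊢
      exact ⟨⟨one_le, not_lt.mp hB⟩, by simpa using Nat.lt_succ_iff.mp hx⟩
  · intro l _
    simp only [ps, PowerSeries.coeff_mk, dif_pos l.pos]
    rfl

theorem good_pow (B : ℕ+) (q : Fin 2) (f : ℕ → PolW W) (hf : Good B f) (t : ℕ) :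
    Good B ((Dq B q ^ t) f) := by
  induction t with
  | zero => simpa using hf
  | succ t ih => rw [pow_succ', Module.End.mul_apply]; exact good_Dq _ _ _ ih

theorem act_pow (B : ℕ+) (q : Fin 2) (f : ℕ → PolW W) (hf : Good B f) (t : ℕ) :
    act (ps q ^ t) f = (Dq B q ^ t) f := by
  induction t with
  | zero => simp [act_one]
  | succ t ih =>
    rw [pow_succ', act_mul, ih, act_ps B q _ (good_pow B q f hf t), pow_succ',
      Module.End.mul_apply]

theorem good_io (B : ℕ+) (h : PolW W) (hh : ∀ q, ∀ l, B < l → pdv (q, l) h = 0) :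
    Good B (io h) := by
  intro m q l hl
  unfold io
  split_ifs
  · exact hh q l hl
  · simp

theorem ex2_eq (B : ℕ+) (h : PolW W) (hh : ∀ q, ∀ l, B < l → pdv (q, l) h = 0)
    (s : Fin 2 → ℕ) (m : ℕ) :
    ex2 s m h = (((-1 : ℂ) ^ (s 0 + s 1)) / (((s 0).factorial : ℂ) * ((s 1).factorial : ℂ))) •
      (Dq B 0 ^ s 0 * Dq B 1 ^ s 1 : Module.End ℂ (ℕ → PolW W)) (io h) m := by
  have hg := good_io B h hh
  rw [Module.End.mul_apply, ← act_pow B 1 _ hg, ← act_pow B 0, ← act_mul, act_io,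
    PowerSeries.coeff_mul, Finset.Nat.sum_antidiagonal_eq_sum_range_succ
      (fun a b => (PowerSeries.coeff a (ps 0 ^ s 0) * PowerSeries.coeff b (ps 1 ^ s 1) :
          Module.End ℂ (PolW W)))]
  · unfold ex2
    rw [LinearMap.smul_apply]
    simp only [Fop_eq]
    rfl
  · rw [act_pow B 1 _ hg]; exact good_pow _ _ _ hg _

theorem Dc_pow_exp (B : ℕ+) (c : ℂ) (n : ℕ) : (Dc B c ^ n : Module.End ℂ (ℕ → PolW W)) =
      ∑ i ∈ Finset.range (n + 1), c ^ i • ((n.choose i : ℂ) • (Dq B 0 ^ (n - i) * Dq B 1 ^ i)) := by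
  have hc : Commute (c • Dq B 1) (Dq B 0 : Module.End ℂ (ℕ → PolW W)) := by
    show _ * _ = _ * _
    rw [smul_mul_assoc, mul_smul_comm, Dq_comm]
  have hc2 : Commute (Dq B 1) (Dq B 0 : Module.End ℂ (ℕ → PolW W)) := Dq_comm _ _ _
  rw [Dc_eq, add_comm, hc.add_pow]
  refine Finset.sum_congr rfl fun i _ => ?_
  rw [smul_pow, smul_mul_assoc, smul_mul_assoc, ← Nat.cast_comm, ← nsmul_eq_mul,
    Nat.cast_smul_eq_nsmul, (hc2.pow_pow _ _).eq]

theorem En_eq (B : ℕ+) (c : ℂ) (n : ℕ) (h : PolW W) (hh : ∀ q, ∀ l, B < l → pdv (q, l) h = 0)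
    (m : ℕ) :
    ∑ i ∈ Finset.range (n + 1), c ^ i • ex2 ![n - i, i] m h =
      ((-1 : ℂ) ^ n / (n.factorial : ℂ)) • (Dc B c ^ n) (io h) m := by
  rw [Dc_pow_exp]
  simp only [LinearMap.sum_apply, Finset.sum_apply, LinearMap.smul_apply, Pi.smul_apply,
    Finset.smul_sum]
  refine Finset.sum_congr rfl fun i hi => ?_
  have hi' : i ≤ n := Nat.lt_succ_iff.mp (Finset.mem_range.mp hi)
  rw [ex2_eq B h hh]
  simp only [Matrix.cons_val_zero, Matrix.cons_val_one]
  rw [smul_smul, smul_smul, smul_smul]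
  congr 1
  rw [Nat.cast_choose ℂ hi', Nat.sub_add_cancel hi']
  have h1 : (n.factorial : ℂ) ≠ 0 := by exact_mod_cast n.factorial_ne_zero
  have h2 : (i.factorial : ℂ) ≠ 0 := by exact_mod_cast i.factorial_ne_zero
  have h3 : ((n - i).factorial : ℂ) ≠ 0 := by exact_mod_cast (n - i).factorial_ne_zero
  field_simp

theorem shift_sum {M : Type*} [AddCommGroup M] [Module ℂ M] (Φ : Fin 2 → (Fin 2 → ℕ) → M)
    (c : ℂ) (n : ℕ) :
    ∑ i ∈ Finset.range (n + 2), c ^ i • ∑ p : Fin 2, (if (![n + 1 - i, i] : Fin 2 → ℕ) p = 0 then 0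
      else Φ p (Function.update ![n + 1 - i, i] p ((![n + 1 - i, i] : Fin 2 → ℕ) p - 1))) =
    ∑ i ∈ Finset.range (n + 1), c ^ i • (Φ 0 ![n - i, i] + c • Φ 1 ![n - i, i]) := by
  simp only [Fin.sum_univ_two, smul_add, Finset.sum_add_distrib]
  congr 1
  · rw [Finset.sum_range_succ, if_pos (by simp), smul_zero, add_zero]
    refine Finset.sum_congr rfl fun i hi => ?_
    have hi' : i ≤ n := Nat.lt_succ_iff.mp (Finset.mem_range.mp hi)
    have hne : ¬ (![n + 1 - i, i] : Fin 2 → ℕ) 0 = 0 := by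
      simp only [Matrix.cons_val_zero]; omega
    rw [if_neg hne]
    congr 2
    ext x
    fin_cases x
    · simp; omega
    · simp
  · rw [Finset.sum_range_succ', if_pos (by simp), smul_zero, add_zero]
    refine Finset.sum_congr rfl fun i hi => ?_
    have hne : ¬ (![n + 1 - (i + 1), i + 1] : Fin 2 → ℕ) 1 = 0 := by simp
    rw [if_neg hne, smul_smul, pow_succ]
    congr 2
    ext x
    fin_cases x <;> simp

theorem Dc_Sh (B : ℕ+) (c : ℂ) (k : ℕ) :
    (Dc B c * Sh k : Module.End ℂ (ℕ → PolW W)) = Sh k * Dc B c := by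
  unfold Dc
  rw [Finset.mul_sum, Finset.sum_mul]
  refine Finset.sum_congr rfl fun l _ => ?_
  unfold so
  rw [mul_assoc, pt_Sh, ← mul_assoc, ← mul_assoc, Sh_mul, Sh_mul, add_comm]

theorem so_io (k : ℕ) (φ : Module.End ℂ (PolW W)) (g : PolW W) :
    so k φ (io g) = Sh k (io (φ g)) := by
  unfold so
  rw [Module.End.mul_apply]
  congr 1
  ext1 m
  rw [pt_apply]
  unfold io
  split_ifs <;> simp

theorem Dq_bdd (B : ℕ+) (q : Fin 2) (f : ℕ → PolW W) (K : ℕ) (hf : ∀ m, K < m → f m = 0) :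
    ∀ m, K + B < m → Dq B q f m = 0 := by
  intro m hm
  rw [Dq_apply]
  refine Finset.sum_eq_zero fun l hl => ?_
  have h1 : (l : ℕ) ≤ B := (Finset.mem_Icc.mp hl).2
  rw [hf _ (by omega)]; simp

theorem Dq_pow_bdd (B : ℕ+) (q : Fin 2) (f : ℕ → PolW W) (K t : ℕ) (hf : ∀ m, K < m → f m = 0) :
    ∀ m, K + t * B < m → (Dq B q ^ t) f m = 0 := by
  induction t with
  | zero => simpa using hf
  | succ t ih =>
    intro m hm
    rw [pow_succ', Module.End.mul_apply]
    exact Dq_bdd B q _ _ ih m (by rw [add_mul] at hm; omega)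

theorem ex2_bdd (B : ℕ+) (h : PolW W) (hh : ∀ q, ∀ l, B < l → pdv (q, l) h = 0)
    (s : Fin 2 → ℕ) (m : ℕ) (hm : (s 0 + s 1) * B < m) : ex2 s m h = 0 := by
  rw [ex2_eq B h hh, Module.End.mul_apply, Dq_pow_bdd B 0 _ (s 1 * B) (s 0), smul_zero]
  · intro m hm
    refine Dq_pow_bdd B 1 _ 0 (s 1) ?_ m (by omega)
    intro m hm
    simp [io, hm.ne']
  · rw [add_mul] at hm; omega

theorem equation (ρ : Fin 2 → Fin 2 → Module.End ℂ W) (g : PolW W) (B B' : ℕ+) (ℓ : ℕ)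
    (hB' : (ℓ + 1) * (B : ℕ) ≤ B')
    (hg : ∀ q, ∀ l, B < l → pdv (q, l) g = 0)
    (heq : ∀ (a : Fin 2) (s : Fin 2 → ℕ) (j : ℕ+), qCoef2 ρ a s j g = 0)
    (c : ℂ) (n j : ℕ) (hn : n ≤ ℓ) (hj : 1 ≤ j) :
    (((n : ℂ) + 1)⁻¹ • ∑ i ∈ Finset.Icc 1 B', mulX (0, i) ((Dc B c ^ (n + 1)) (io g) (i + j)) :
        PolW W) =
      pt (rhoOp (ρ 0 0 + c • ρ 1 0)) ((Dc B c ^ n) (io g)) j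
        + (Dc B c ^ n) (Tc B c (io g)) j := by
  have hgood : ∀ (i k : ℕ+), i ≤ B → ∀ q, ∀ l, B < l → pdv (q, l) (mulX (0, i) (dd c k g)) = 0 := by
    intro i k hi q l hl
    rw [← Module.End.mul_apply, pdv_mulX_ne _ _ (fun h => ?_), Module.End.mul_apply,
      ← Module.End.mul_apply (pdv _), ← dd_pdv, Module.End.mul_apply, hg q l hl, map_zero, map_zero]
    rw [(Prod.mk.inj h).2] at hl
    exact absurd hi (not_le.mpr hl)
  -- summing the equations
  obtain ⟨j', rfl⟩ : ∃ j' : ℕ+, (j' : ℕ) = j := ⟨⟨j, hj⟩, rfl⟩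
  have hsum : ∑ i ∈ Finset.range (n + 2), c ^ i • qCoef2 ρ 0 ![n + 1 - i, i] j' g = 0 :=
    Finset.sum_eq_zero fun i _ => by rw [heq, smul_zero]
  have h1 : ∀ i ∈ Finset.range (n + 2),
      (∑ᶠ k : ℕ+, mulX (0, k) (ex2 ![n + 1 - i, i] ((k : ℕ) + j') g)) =
      ∑ k ∈ Finset.Icc 1 B', mulX (0, k) (ex2 ![n + 1 - i, i] ((k : ℕ) + j') g) := by
    intro i hi
    apply finsum_eq_finsetSum_of_support_subset
    intro k hk
    rw [Function.mem_support] at hk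
    simp only [Finset.coe_Icc, Set.mem_Icc]
    refine ⟨one_le, ?_⟩
    by_contra hkB
    have hkB' : (B' : ℕ) < k := not_le.mp hkB
    apply hk
    rw [ex2_bdd B g hg, map_zero]
    have hi' := Finset.mem_range.mp hi
    simp only [Matrix.cons_val_zero, Matrix.cons_val_one]
    rw [Nat.sub_add_cancel (by omega)]
    calc (n + 1) * (B : ℕ) ≤ (ℓ + 1) * B := Nat.mul_le_mul_right _ (by omega)
      _ < k + j' := by omega
  have h3 : ∀ (p : Fin 2) (s : Fin 2 → ℕ),
      (∑ᶠ k : ℕ+, ∑ᶠ i : ℕ+,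
        if (i : ℕ) < (k : ℕ) ∧ (k : ℕ) ≤ (i : ℕ) + j' then
          ex2 s ((i : ℕ) + j' - (k : ℕ)) (mulX (0, i) (pdv (p, k) g)) else 0) =
      ∑ k ∈ Finset.Icc 1 B, ∑ i ∈ Finset.Icc 1 B,
        if (i : ℕ) < (k : ℕ) ∧ (k : ℕ) ≤ (i : ℕ) + j' then
          ex2 s ((i : ℕ) + j' - (k : ℕ)) (mulX (0, i) (pdv (p, k) g)) else 0 := by
    intro p s
    rw [finsum_eq_finsetSum_of_support_subset (s := Finset.Icc 1 B)]
    · refine Finset.sum_congr rfl fun k hk => ?_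
      apply finsum_eq_finsetSum_of_support_subset
      intro i hi
      rw [Function.mem_support] at hi
      simp only [Finset.coe_Icc, Set.mem_Icc]
      refine ⟨one_le, ?_⟩
      by_contra hiB
      apply hi
      rw [if_neg]
      rintro ⟨h, _⟩
      exact hiB ((show i < k from h).le.trans (Finset.mem_Icc.mp hk).2)
    · intro k hk
      rw [Function.mem_support] at hk
      simp only [Finset.coe_Icc, Set.mem_Icc]
      refine ⟨one_le, ?_⟩
      by_contra hkB
      apply hk
      rw [hg p k (not_le.mp hkB)]
      simp
  have hq : ∀ i ∈ Finset.range (n + 2), c ^ i • qCoef2 ρ 0 ![n + 1 - i, i] j' g =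
      c ^ i • (∑ k ∈ Finset.Icc 1 B', mulX (0, k) (ex2 ![n + 1 - i, i] ((k : ℕ) + j') g)) +
      c ^ i • (∑ p : Fin 2, (if (![n + 1 - i, i] : Fin 2 → ℕ) p = 0 then 0
        else (fun (p : Fin 2) (s : Fin 2 → ℕ) => rhoOp (ρ p 0) (ex2 s j' g)) p
          (Function.update ![n + 1 - i, i] p ((![n + 1 - i, i] : Fin 2 → ℕ) p - 1)))) +
      c ^ i • (∑ p : Fin 2, (if (![n + 1 - i, i] : Fin 2 → ℕ) p = 0 then 0
        else (fun (p : Fin 2) (s : Fin 2 → ℕ) => ∑ k ∈ Finset.Icc 1 B, ∑ i ∈ Finset.Icc 1 B,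
        if (i : ℕ) < (k : ℕ) ∧ (k : ℕ) ≤ (i : ℕ) + j' then
          ex2 s ((i : ℕ) + j' - (k : ℕ)) (mulX (0, i) (pdv (p, k) g)) else 0) p
          (Function.update ![n + 1 - i, i] p ((![n + 1 - i, i] : Fin 2 → ℕ) p - 1)))) := by
    intro i hi
    rw [← smul_add, ← smul_add]
    unfold qCoef2
    simp only [PNat.mk_coe, h3]
    rw [h1 i hi]
  rw [Finset.sum_congr rfl hq, Finset.sum_add_distrib, Finset.sum_add_distrib,
    shift_sum (fun (p : Fin 2) (s : Fin 2 → ℕ) => rhoOp (ρ p 0) (ex2 s j' g)) c n,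
    shift_sum (fun (p : Fin 2) (s : Fin 2 → ℕ) => ∑ k ∈ Finset.Icc 1 B, ∑ i ∈ Finset.Icc 1 B,
        if (i : ℕ) < (k : ℕ) ∧ (k : ℕ) ≤ (i : ℕ) + j' then
          ex2 s ((i : ℕ) + j' - (k : ℕ)) (mulX (0, i) (pdv (p, k) g)) else 0) c n] at hsum
  have e1 : ∑ i ∈ Finset.range (n + 2),
      c ^ i • (∑ k ∈ Finset.Icc 1 B', mulX (0, k) (ex2 ![n + 1 - i, i] ((k : ℕ) + j') g)) =
      ((-1 : ℂ) ^ (n + 1) / ((n + 1).factorial : ℂ)) •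
        ∑ k ∈ Finset.Icc 1 B', mulX (0, k) ((Dc B c ^ (n + 1)) (io g) (k + j')) := by
    simp only [Finset.smul_sum]
    rw [Finset.sum_comm]
    refine Finset.sum_congr rfl fun k _ => ?_
    rw [← map_smul, ← En_eq B c (n + 1) g hg, map_sum]
    simp only [map_smul]
  have e2 : ∑ i ∈ Finset.range (n + 1),
      c ^ i • (rhoOp (ρ 0 0) (ex2 ![n - i, i] j' g) + c • rhoOp (ρ 1 0) (ex2 ![n - i, i] j' g)) =
      ((-1 : ℂ) ^ n / (n.factorial : ℂ)) •
        pt (rhoOp (ρ 0 0 + c • ρ 1 0)) ((Dc B c ^ n) (io g)) j' := by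
    rw [pt_apply, ← map_smul, ← En_eq B c n g hg, map_sum]
    refine Finset.sum_congr rfl fun i _ => ?_
    have : (rhoOp (ρ 0 0 + c • ρ 1 0) : Module.End ℂ (PolW W)) =
        rhoOp (ρ 0 0) + c • rhoOp (ρ 1 0) := by
      refine Finsupp.lhom_ext fun m w => ?_
      simp [rhoOp_single]
    rw [this, map_smul]
    rfl
  have e3 : ∑ i ∈ Finset.range (n + 1),
      c ^ i • ((∑ k ∈ Finset.Icc 1 B, ∑ l ∈ Finset.Icc 1 B,
        if (l : ℕ) < (k : ℕ) ∧ (k : ℕ) ≤ (l : ℕ) + j' then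
          ex2 ![n - i, i] ((l : ℕ) + j' - (k : ℕ)) (mulX (0, l) (pdv (0, k) g)) else 0) +
        c • (∑ k ∈ Finset.Icc 1 B, ∑ l ∈ Finset.Icc 1 B,
        if (l : ℕ) < (k : ℕ) ∧ (k : ℕ) ≤ (l : ℕ) + j' then
          ex2 ![n - i, i] ((l : ℕ) + j' - (k : ℕ)) (mulX (0, l) (pdv (1, k) g)) else 0)) =
      ((-1 : ℂ) ^ n / (n.factorial : ℂ)) • (Dc B c ^ n) (Tc B c (io g)) j' := by
    have hT : (Dc B c ^ n) (Tc B c (io g)) j' = ∑ k ∈ Finset.Icc 1 B, ∑ l ∈ Finset.Icc 1 B,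
        if (l : ℕ) < (k : ℕ) ∧ (k : ℕ) ≤ (l : ℕ) + j' then
          (Dc B c ^ n) (io (mulX (0, l) (dd c k g))) (l + j' - k) else 0 := by
      unfold Tc
      simp only [LinearMap.sum_apply, map_sum, Finset.sum_apply]
      refine Finset.sum_congr rfl fun k _ => Finset.sum_congr rfl fun l _ => ?_
      have hc : Commute (Dc B c ^ n) (Sh ((k : ℕ) - l) : Module.End ℂ (ℕ → PolW W)) :=
        Commute.pow_left (Dc_Sh B c _) n
      by_cases hlk : l < k
      · have hlk' : (l : ℕ) < k := hlk
        rw [if_pos hlk, so_io, ← Module.End.mul_apply, hc.eq, Module.End.mul_apply, Sh_apply]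
        by_cases hk : (k : ℕ) ≤ l + j'
        · rw [if_pos (by omega), if_pos ⟨hlk', hk⟩, Module.End.mul_apply]
          rw [show (j' : ℕ) - ((k : ℕ) - l) = l + j' - k by omega]
        · rw [if_neg (by omega), if_neg (by tauto)]
      · rw [if_neg hlk, if_neg (fun h => hlk h.1)]
        simp
    rw [hT]
    simp only [Finset.smul_sum, ← Finset.sum_add_distrib]
    rw [Finset.sum_comm]
    refine Finset.sum_congr rfl fun k _ => ?_
    rw [Finset.sum_comm]
    refine Finset.sum_congr rfl fun l hl => ?_
    by_cases h : (l : ℕ) < (k : ℕ) ∧ (k : ℕ) ≤ (l : ℕ) + j'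
    · simp only [if_pos h]
      rw [← En_eq B c n _ (hgood l k (Finset.mem_Icc.mp hl).2)]
      refine Finset.sum_congr rfl fun i _ => ?_
      simp [dd]
    · simp only [if_neg h, smul_zero, add_zero, Finset.sum_const_zero]
  simp only [e1, e2, e3] at hsum
  have hfac : ((-1 : ℂ) ^ n / (n.factorial : ℂ)) ≠ 0 :=
    div_ne_zero (pow_ne_zero _ (by norm_num)) (by exact_mod_cast n.factorial_ne_zero)
  have hn1 : ((n : ℂ) + 1) ≠ 0 := Nat.cast_add_one_ne_zero n
  have hco : ((-1 : ℂ) ^ (n + 1) / ((n + 1).factorial : ℂ)) =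
      ((-1 : ℂ) ^ n / (n.factorial : ℂ)) * (-((n : ℂ) + 1)⁻¹) := by
    have : (n.factorial : ℂ) ≠ 0 := by exact_mod_cast n.factorial_ne_zero
    rw [Nat.factorial_succ]
    push_cast
    field_simp
    ring
  rw [hco, mul_smul, ← smul_add, ← smul_add, smul_eq_zero] at hsum
  have hfin := hsum.resolve_left hfac
  rw [neg_smul, add_assoc, neg_add_eq_zero] at hfin
  exact hfin

theorem pdv_big (B : ℕ+) (g : PolW W) (hB : ∀ μ ∈ g.support, ∀ v, μ v ≠ 0 → v.2 ≤ B)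
    (q : Fin 2) (l : ℕ+) (hl : B < l) : pdv (q, l) g = 0 := by
  unfold pdv
  rw [Finsupp.lsum_apply, Finsupp.sum]
  refine Finset.sum_eq_zero fun μ hμ => ?_
  have : μ (q, l) = 0 := by
    by_contra h
    exact absurd (hB μ hμ _ h) (not_le.mpr hl)
  simp [this]

theorem eu_len (B : ℕ+) (g : PolW W) (ℓ : ℕ) (hB : ∀ μ ∈ g.support, ∀ v, μ v ≠ 0 → v.2 ≤ B)
    (hlen : ∀ μ ∈ g.support, (μ.sum fun _ n => n) = ℓ) : eu B g = (ℓ : ℂ) • g := by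
  ext μ
  rw [eu_apply, Finsupp.smul_apply]
  by_cases hμ : μ ∈ g.support
  · congr 2
    rw [← hlen μ hμ, ← Finset.sum_product', Finsupp.sum_of_support_subset _ (s := Finset.univ ×ˢ Finset.Icc 1 B)]
    · intro v hv
      simp only [Finset.mem_product, Finset.mem_univ, true_and, Finset.mem_Icc]
      exact ⟨one_le, hB μ hμ v (Finsupp.mem_support_iff.mp hv)⟩
    · simp
  · rw [Finsupp.notMem_support_iff.mp hμ]; simp

/-- let `W` be a finite-dimensional `gl_2`-module and let
`ĝ ∈ ℂ[x_{pj} : 1 ≤ p ≤ 2, j ≥ 1] ⊗ W` be non-constant, homogeneous of total length `ℓ`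
and of total degree `d`, with `Q_a(r,z)_− ĝ = 0` for `a = 1,2` (all coefficients of
monomials in `r` times negative powers of `z` vanish).  Then the total length of `ĝ`
is `1`. -/
theorem stmt16 [FiniteDimensional ℂ W]
    (ρ : Fin 2 → Fin 2 → Module.End ℂ W) (hρ : IsGLRep ρ)
    (g : PolW W) (ℓ d : ℕ)
    (hlen : ∀ μ ∈ g.support, (μ.sum fun _ n => n) = ℓ)
    (hdeg : ∀ μ ∈ g.support, (μ.sum fun v n => n * (v.2 : ℕ)) = d)
    (hnc : ¬ ∃ w : W, g = Finsupp.single 0 w)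
    (heq : ∀ (a : Fin 2) (s : Fin 2 → ℕ) (j : ℕ+), qCoef2 ρ a s j g = 0) :
    ℓ = 1 := by
  have hB : ∀ μ ∈ g.support, ∀ v, μ v ≠ 0 → v.2 ≤ d.succPNat := by
    intro μ hμ v hv
    have h1 : μ v * (v.2 : ℕ) ≤ d := by
      rw [← hdeg μ hμ, Finsupp.sum]
      exact Finset.single_le_sum (f := fun v : Fin 2 × ℕ+ => μ v * (v.2 : ℕ))
        (fun _ _ => Nat.zero_le _) (Finsupp.mem_support_iff.mpr hv)
    have h2 : (v.2 : ℕ) ≤ μ v * (v.2 : ℕ) := Nat.le_mul_of_pos_left _ (Nat.pos_of_ne_zero hv)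
    have h3 : (v.2 : ℕ) ≤ (d.succPNat : ℕ) := by rw [Nat.succPNat_coe]; omega
    exact h3
  by_contra hne
  rcases Nat.lt_or_ge ℓ 2 with h | h
  · have h0 : ℓ = 0 := by omega
    subst h0
    apply hnc
    refine ⟨g 0, ?_⟩
    rw [← Finsupp.support_subset_singleton]
    intro μ hμ
    rw [Finset.mem_singleton]
    have h1 := hlen μ hμ
    ext v
    by_contra hv
    have h2 : μ v ≤ 0 := by
      rw [← h1, Finsupp.sum]
      exact Finset.single_le_sum (f := fun v : Fin 2 × ℕ+ => μ v)
        (fun _ _ => Nat.zero_le _) (Finsupp.mem_support_iff.mpr hv)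
    exact hv (Nat.le_zero.mp h2)
  · apply hnc
    refine ⟨0, ?_⟩
    rw [Finsupp.single_zero]
    have hco : (((ℓ.succPNat) * d.succPNat : ℕ+) : ℕ) = (ℓ + 1) * (d.succPNat : ℕ) := by
      simp
    refine abstract_main d.succPNat (ℓ.succPNat * d.succPNat) ?_ g ℓ h
      (eu_len _ g ℓ hB hlen) (fun c => ρ 0 0 + c • ρ 1 0) ?_
    · have : (d.succPNat : ℕ) ≤ ((ℓ.succPNat) * d.succPNat : ℕ+) := by
        rw [hco]; exact Nat.le_mul_of_pos_left _ (Nat.succ_pos _)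
      exact this
    · intro c n j hn hj
      exact equation ρ g _ _ ℓ hco.ge (pdv_big _ g hB) heq c n j hn hj

end
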